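/- arXiv:1811.04194 — 3 statements merged into one kernel-verified Lean document; each statement's English description precedes it below -/
import Mathlib

section
/- Let E be a real inner product space and f : E → ℝ differentiable with L-Lipschitz gradient (L > 0). Then for every x, v ∈ E, the step x⁺ = x − v/(2L) satisfies f(x⁺) − f(x) ≤ −(1/(8L))·‖v‖² + (1/(4L))·‖∇f(x) − v‖². -/
/-- The quadratic upper bound for a function whose gradient is `L`-Lipschitz. -/
theorem le_add_inner_add_of_lipschitz_gradient
    {E : Type*} [NormedAddCommGroup E] [InnerProductSpace ℝ E]
    {f : E → ℝ} {f' : E → E} {L : ℝ}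
    (hdiff : ∀ x, HasFDerivAt f (innerSL ℝ (f' x)) x)
    (hlip : ∀ x y, ‖f' x - f' y‖ ≤ L * ‖x - y‖) (x u : E) :
    f (x + u) ≤ f x + inner ℝ (f' x) u + L / 2 * ‖u‖ ^ 2 := by
  let φ : ℝ → ℝ := fun t => f (x + t • u) - t * inner ℝ (f' x) u - L / 2 * ‖u‖ ^ 2 * t ^ 2
  have hφ : ∀ t, HasDerivAt φ
      (inner ℝ (f' (x + t • u)) u - inner ℝ (f' x) u - L * ‖u‖ ^ 2 * t) t := by
    intro t
    have hline : HasDerivAt (fun t : ℝ => x + t • u) u t := by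
      simpa using ((hasDerivAt_id t).smul_const u).const_add x
    have hf : HasDerivAt (fun t : ℝ => f (x + t • u)) (inner ℝ (f' (x + t • u)) u) t := by
      simpa [Function.comp_def] using (hdiff (x + t • u)).comp_hasDerivAt t hline
    have hlin := (hasDerivAt_id t).mul_const (inner ℝ (f' x) u)
    have hsq := (hasDerivAt_pow 2 t).const_mul (L / 2 * ‖u‖ ^ 2)
    refine ((hf.sub hlin).sub hsq).congr_deriv ?_
    push_cast
    ring
  have hanti : AntitoneOn φ (Set.Icc 0 1) := by
    refine antitoneOn_of_deriv_nonpos (convex_Icc 0 1)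
      (fun t _ => (hφ t).continuousAt.continuousWithinAt)
      (fun t _ => (hφ t).differentiableAt.differentiableWithinAt) fun t ht => ?_
    rw [interior_Icc] at ht
    rw [(hφ t).deriv, ← inner_sub_left, sub_nonpos]
    have hgrad : ‖f' (x + t • u) - f' x‖ ≤ L * (t * ‖u‖) := by
      simpa [norm_smul, abs_of_pos ht.1] using hlip (x + t • u) x
    calc inner ℝ (f' (x + t • u) - f' x) u
        ≤ ‖f' (x + t • u) - f' x‖ * ‖u‖ := real_inner_le_norm _ _
      _ ≤ L * (t * ‖u‖) * ‖u‖ := by gcongr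
      _ = L * ‖u‖ ^ 2 * t := by ring
  have h := hanti (Set.left_mem_Icc.2 zero_le_one) (Set.right_mem_Icc.2 zero_le_one) zero_le_one
  simp only [φ, one_smul, zero_smul, add_zero] at h
  linarith


/-- Let `E` be a real inner product space and `f : E → ℝ`
differentiable with `L`-Lipschitz gradient `f'` (`L > 0`). Then for every
`x, v ∈ E`, the step `x⁺ = x − v/(2L)` satisfies
`f x⁺ − f x ≤ −(1/(8L)) ‖v‖² + (1/(4L)) ‖∇f(x) − v‖²`. -/
theorem stmt_1
    {E : Type*} [NormedAddCommGroup E] [InnerProductSpace ℝ E]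
    (f : E → ℝ) (f' : E → E) (L : ℝ) (hL : 0 < L)
    (hdiff : ∀ x, HasFDerivAt f (innerSL ℝ (f' x)) x)
    (hlip : ∀ x y, ‖f' x - f' y‖ ≤ L * ‖x - y‖)
    (x v : E) :
    f (x - (1 / (2 * L)) • v) - f x
      ≤ -(1 / (8 * L)) * ‖v‖ ^ 2 + (1 / (4 * L)) * ‖f' x - v‖ ^ 2 := by
  have h := le_add_inner_add_of_lipschitz_gradient hdiff hlip x (-((1 / (2 * L)) • v))
  rw [← sub_eq_add_neg, inner_neg_right, real_inner_smul_right, norm_neg, norm_smul, mul_pow,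
    Real.norm_eq_abs, sq_abs] at h
  rw [norm_sub_sq_real]
  have hsq : 0 ≤ 1 / (4 * L) * ‖f' x‖ ^ 2 := by positivity
  have hcoeff : L / 2 * ((1 / (2 * L)) ^ 2 * ‖v‖ ^ 2) = 1 / (8 * L) * ‖v‖ ^ 2 := by
    field_simp
    ring
  have hexpand : -(1 / (8 * L)) * ‖v‖ ^ 2
      + 1 / (4 * L) * (‖f' x‖ ^ 2 - 2 * inner ℝ (f' x) v + ‖v‖ ^ 2)
      = 1 / (4 * L) * ‖f' x‖ ^ 2 - 1 / (2 * L) * inner ℝ (f' x) v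
        + 1 / (8 * L) * ‖v‖ ^ 2 := by
    field_simp
    ring
  linarith
end

section
/- Let E be a real inner product space and f : E → ℝ differentiable with L-Lipschitz gradient (L > 0). Assume f is τ-gradient dominated with global minimizer x*, and that 4Lτ ≥ 1. Let δ ≥ 0, let q be a natural number with q ≥ 4Lτ·log 4, and let x_0, x_1, …, x_q be a sequence with x_{k+1} = x_k − v_k/(2L) where each v_k ∈ E satisfies ‖v_k − ∇f(x_k)‖² ≤ δ. Then f(x_q) − f(x*) ≤ max{ (f(x_0) − f(x*))/2 , 2δτ }. -/
/-- The descent lemma: a function with `L`-Lipschitz gradient lies below its quadratic model. -/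
theorem le_quadratic_of_lipschitz_gradient
    {E : Type*} [NormedAddCommGroup E] [InnerProductSpace ℝ E]
    {f : E → ℝ} {f' : E → E} {L : ℝ}
    (hdiff : ∀ x, HasFDerivAt f (innerSL ℝ (f' x)) x)
    (hlip : ∀ x y, ‖f' x - f' y‖ ≤ L * ‖x - y‖) (x w : E) :
    f (x + w) ≤ f x + inner ℝ (f' x) w + L / 2 * ‖w‖ ^ 2 := by
  have hderiv : ∀ t : ℝ, HasDerivAt
      (fun t : ℝ => f (x + t • w) - t * inner ℝ (f' x) w - L / 2 * ‖w‖ ^ 2 * t ^ 2)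
      (inner ℝ (f' (x + t • w)) w - inner ℝ (f' x) w - L * ‖w‖ ^ 2 * t) t := by
    intro t
    have hline : HasDerivAt (fun t : ℝ => x + t • w) w t := by
      simpa using ((hasDerivAt_id t).smul_const w).const_add x
    have hf : HasDerivAt (fun t : ℝ => f (x + t • w)) (inner ℝ (f' (x + t • w)) w) t := by
      have hcomp := (hdiff (x + t • w)).comp_hasDerivAt t hline
      exact hcomp
    have hlin := (hasDerivAt_id t).mul_const (inner ℝ (f' x) w)
    have hquad := (hasDerivAt_pow 2 t).const_mul (L / 2 * ‖w‖ ^ 2)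
    refine ((hf.sub hlin).sub hquad).congr_deriv ?_
    norm_num
    ring
  have hanti := antitoneOn_of_deriv_nonpos (convex_Icc (0 : ℝ) 1)
    (fun t _ => (hderiv t).continuousAt.continuousWithinAt)
    (fun t _ => (hderiv t).differentiableAt.differentiableWithinAt)
    (fun t ht => by
      rw [interior_Icc] at ht
      rw [(hderiv t).deriv, ← inner_sub_left]
      have hgrad := hlip (x + t • w) x
      rw [add_sub_cancel_left, norm_smul, Real.norm_of_nonneg ht.1.le] at hgrad
      nlinarith [real_inner_le_norm (f' (x + t • w) - f' x) w,
        mul_le_mul_of_nonneg_right hgrad (norm_nonneg w)])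
  have h := hanti (Set.left_mem_Icc.2 zero_le_one) (Set.right_mem_Icc.2 zero_le_one) zero_le_one
  norm_num at h
  linarith

/-- One gradient step of size `1 / (2 * L)` along an inexact gradient `v`. -/
theorem inexact_gradient_step_le
    {E : Type*} [NormedAddCommGroup E] [InnerProductSpace ℝ E]
    {f : E → ℝ} {f' : E → E} {L : ℝ} (hL : 0 < L)
    (hdiff : ∀ x, HasFDerivAt f (innerSL ℝ (f' x)) x)
    (hlip : ∀ x y, ‖f' x - f' y‖ ≤ L * ‖x - y‖) (x v : E) :
    f (x - (1 / (2 * L)) • v) ≤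
      f x - ‖f' x‖ ^ 2 / (4 * L) + ‖v - f' x‖ ^ 2 / (4 * L) := by
  have h := le_quadratic_of_lipschitz_gradient hdiff hlip x (-((1 / (2 * L)) • v))
  rw [← sub_eq_add_neg, inner_neg_right, real_inner_smul_right, norm_neg, norm_smul,
    Real.norm_of_nonneg (by positivity), mul_pow] at h
  have hgap : f x - ‖f' x‖ ^ 2 / (4 * L) + ‖v - f' x‖ ^ 2 / (4 * L)
      - (f x + -(1 / (2 * L) * inner ℝ (f' x) v) + L / 2 * ((1 / (2 * L)) ^ 2 * ‖v‖ ^ 2))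
      = ‖v‖ ^ 2 / (8 * L) := by
    rw [norm_sub_sq_real, real_inner_comm]
    field_simp
    ring
  have : 0 ≤ ‖v‖ ^ 2 / (8 * L) := by positivity
  linarith

/-- Let `E` be a real inner product space and `f : E → ℝ`
differentiable with `L`-Lipschitz gradient `f'` (`L > 0`). Assume `f` is
`τ`-gradient dominated with global minimizer `x*`, and that `4Lτ ≥ 1`.
Let `δ ≥ 0`, let `q` be a natural number with `q ≥ 4Lτ·log 4`, and let
`x_0, …, x_q` satisfy `x_{k+1} = x_k − v_k/(2L)` where each `v_k`
satisfies `‖v_k − ∇f(x_k)‖² ≤ δ`. Then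
`f(x_q) − f(x*) ≤ max { (f(x_0) − f(x*))/2 , 2δτ }`. -/
theorem stmt_7
    {E : Type*} [NormedAddCommGroup E] [InnerProductSpace ℝ E]
    (f : E → ℝ) (f' : E → E) (L τ : ℝ) (hL : 0 < L) (hτ : 0 < τ)
    (hdiff : ∀ x, HasFDerivAt f (innerSL ℝ (f' x)) x)
    (hlip : ∀ x y, ‖f' x - f' y‖ ≤ L * ‖x - y‖)
    (xstar : E) (hmin : ∀ y, f xstar ≤ f y)
    (hdom : ∀ x, f x - f xstar ≤ τ * ‖f' x‖ ^ 2)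
    (hκ : 1 ≤ 4 * L * τ)
    (δ : ℝ) (hδ : 0 ≤ δ)
    (q : ℕ) (hq : 4 * L * τ * Real.log 4 ≤ q)
    (x v : ℕ → E)
    (hupd : ∀ k < q, x (k + 1) = x k - (1 / (2 * L)) • v k)
    (herr : ∀ k < q, ‖v k - f' (x k)‖ ^ 2 ≤ δ) :
    f (x q) - f xstar ≤ max ((f (x 0) - f xstar) / 2) (2 * δ * τ) := by
  have hκ0 : 0 < 4 * L * τ := by positivity
  set r : ℝ := 1 - 1 / (4 * L * τ) with hr
  have hr0 : 0 ≤ r := sub_nonneg.2 ((div_le_one hκ0).2 hκ)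
  have hstep : ∀ k < q, f (x (k + 1)) - f xstar ≤ r * (f (x k) - f xstar) + δ / (4 * L) := by
    intro k hk
    have hdescent := inexact_gradient_step_le hL hdiff hlip (x k) (v k)
    rw [← hupd k hk] at hdescent
    have hnoise : ‖v k - f' (x k)‖ ^ 2 / (4 * L) ≤ δ / (4 * L) := by
      gcongr
      exact herr k hk
    have hgrad : (f (x k) - f xstar) / (4 * L * τ) ≤ ‖f' (x k)‖ ^ 2 / (4 * L) := by
      rw [div_le_div_iff₀ hκ0 (by positivity)]
      nlinarith [hdom (x k)]
    have hexpand : r * (f (x k) - f xstar)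
        = f (x k) - f xstar - (f (x k) - f xstar) / (4 * L * τ) := by
      rw [hr]
      ring
    linarith
  have hiter : ∀ k ≤ q, f (x k) - f xstar ≤ r ^ k * (f (x 0) - f xstar) + δ * τ := by
    intro k
    induction k with
    | zero =>
      intro _
      have : 0 ≤ δ * τ := by positivity
      simpa using this
    | succ k ih =>
      intro hk
      have hprev := mul_le_mul_of_nonneg_left (ih (by lia)) hr0
      have hfix : r * (δ * τ) + δ / (4 * L) = δ * τ := by
        rw [hr]
        field_simp
        ring
      rw [pow_succ]
      linarith [hstep k (by lia)]
  have hrq : r ^ q ≤ 1 / 4 := by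
    calc r ^ q ≤ Real.exp (-(1 / (4 * L * τ))) ^ q :=
          pow_le_pow_left₀ hr0 (Real.one_sub_le_exp_neg _) q
      _ = Real.exp (-(q / (4 * L * τ))) := by
          rw [← Real.exp_nat_mul]
          ring_nf
      _ ≤ Real.exp (-Real.log 4) := by
          gcongr
          rw [le_div_iff₀ hκ0]
          linarith
      _ = 1 / 4 := by
          rw [Real.exp_neg, Real.exp_log (by norm_num)]
          norm_num
  have hcontract := mul_le_mul_of_nonneg_right hrq (sub_nonneg.2 (hmin (x 0)))
  linarith [hiter q le_rfl, le_max_left ((f (x 0) - f xstar) / 2) (2 * δ * τ),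
    le_max_right ((f (x 0) - f xstar) / 2) (2 * δ * τ)]
end

section
/- Let E be a real inner product space and f : E → ℝ differentiable with L-Lipschitz gradient (L > 0), bounded below by f* (f(x) ≥ f* for all x). Let x_0, x_1, …, x_T be generated by x_{k+1} = x_k − v_k/(2L) for arbitrary vectors v_k ∈ E. Then Σ_{k=0}^{T−1} ‖v_k‖² ≤ 8L·(f(x_0) − f*) + 2·Σ_{k=0}^{T−1} ‖∇f(x_k) − v_k‖². -/
/-- The descent lemma: a function with `L`-Lipschitz gradient is bounded above by its
quadratic model. -/
theorem descent_of_lipschitz_gradient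
    {E : Type*} [NormedAddCommGroup E] [InnerProductSpace ℝ E]
    {f : E → ℝ} {f' : E → E} {L : ℝ}
    (hdiff : ∀ x, HasFDerivAt f (innerSL ℝ (f' x)) x)
    (hlip : ∀ x y, ‖f' x - f' y‖ ≤ L * ‖x - y‖) (x d : E) :
    f (x + d) ≤ f x + inner ℝ (f' x) d + L / 2 * ‖d‖ ^ 2 := by
  have hf (t : ℝ) : HasDerivAt (fun s : ℝ => f (x + s • d)) (inner ℝ (f' (x + t • d)) d) t := by
    have hline : HasDerivAt (fun s : ℝ => x + s • d) d t := by
      simpa using ((hasDerivAt_id t).smul_const d).const_add x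
    exact (hdiff (x + t • d)).comp_hasDerivAt t hline
  have hB (t : ℝ) : HasDerivAt
      (fun s : ℝ => f x + s * inner ℝ (f' x) d + L / 2 * ‖d‖ ^ 2 * s ^ 2)
      (inner ℝ (f' x) d + L * ‖d‖ ^ 2 * t) t := by
    refine ((((hasDerivAt_id t).mul_const (inner ℝ (f' x) d)).const_add (f x)).add
      ((hasDerivAt_pow 2 t).const_mul (L / 2 * ‖d‖ ^ 2))).congr_deriv ?_
    norm_num
    ring
  have key := image_le_of_deriv_right_le_deriv_boundary (a := 0) (b := 1)
    (fun t _ => (hf t).continuousAt.continuousWithinAt) (fun t _ => (hf t).hasDerivWithinAt)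
    (by simp) (fun t _ => (hB t).continuousAt.continuousWithinAt)
    (fun t _ => (hB t).hasDerivWithinAt) (fun t ht => ?_) (Set.right_mem_Icc.2 zero_le_one)
  · simpa using key
  · have hgrad : ‖f' (x + t • d) - f' x‖ ≤ L * (t * ‖d‖) := by
      simpa [norm_smul, abs_of_nonneg ht.1] using hlip (x + t • d) x
    have hinner := real_inner_le_norm (f' (x + t • d) - f' x) d
    rw [inner_sub_left] at hinner
    nlinarith [mul_le_mul_of_nonneg_right hgrad (norm_nonneg d)]

/-- Progress of one step of length `1 / (2 * L)` along an inexact gradient `v`. -/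
theorem norm_sq_le_of_inexact_gradient_step
    {E : Type*} [NormedAddCommGroup E] [InnerProductSpace ℝ E]
    {f : E → ℝ} {f' : E → E} {L : ℝ} (hL : 0 < L)
    (hdiff : ∀ x, HasFDerivAt f (innerSL ℝ (f' x)) x)
    (hlip : ∀ x y, ‖f' x - f' y‖ ≤ L * ‖x - y‖) (x v : E) :
    ‖v‖ ^ 2 ≤ 8 * L * (f x - f (x - (1 / (2 * L)) • v)) + 2 * ‖f' x - v‖ ^ 2 := by
  have h := descent_of_lipschitz_gradient hdiff hlip x (-((1 / (2 * L)) • v))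
  rw [← sub_eq_add_neg, inner_neg_right, real_inner_smul_right, norm_neg, norm_smul, mul_pow,
    Real.norm_eq_abs, sq_abs] at h
  have h8 := mul_le_mul_of_nonneg_left h (by positivity : 0 ≤ 8 * L)
  have hmodel : 8 * L * (f x + -(1 / (2 * L) * inner ℝ (f' x) v)
      + L / 2 * ((1 / (2 * L)) ^ 2 * ‖v‖ ^ 2))
      = 8 * L * f x - 4 * inner ℝ (f' x) v + ‖v‖ ^ 2 := by
    field_simp
    ring
  rw [hmodel] at h8
  linarith [norm_sub_sq_real (f' x) v, sq_nonneg ‖f' x‖]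

/-- Let `E` be a real inner product space and `f : E → ℝ`
differentiable with `L`-Lipschitz gradient `f'` (`L > 0`), bounded below by
`f*`. Let `x_0, …, x_T` be generated by `x_{k+1} = x_k − v_k/(2L)` for
arbitrary vectors `v_k`. Then
`Σ_{k<T} ‖v_k‖² ≤ 8L (f(x_0) − f*) + 2 Σ_{k<T} ‖∇f(x_k) − v_k‖²`. -/
theorem stmt_9
    {E : Type*} [NormedAddCommGroup E] [InnerProductSpace ℝ E]
    (f : E → ℝ) (f' : E → E) (L fstar : ℝ) (hL : 0 < L)
    (hdiff : ∀ x, HasFDerivAt f (innerSL ℝ (f' x)) x)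
    (hlip : ∀ x y, ‖f' x - f' y‖ ≤ L * ‖x - y‖)
    (hbdd : ∀ x, fstar ≤ f x)
    (T : ℕ) (x v : ℕ → E)
    (hupd : ∀ k < T, x (k + 1) = x k - (1 / (2 * L)) • v k) :
    ∑ k ∈ Finset.range T, ‖v k‖ ^ 2
      ≤ 8 * L * (f (x 0) - fstar)
        + 2 * ∑ k ∈ Finset.range T, ‖f' (x k) - v k‖ ^ 2 := by
  have hstep : ∀ k ∈ Finset.range T,
      ‖v k‖ ^ 2 ≤ 8 * L * (f (x k) - f (x (k + 1))) + 2 * ‖f' (x k) - v k‖ ^ 2 := by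
    intro k hk
    rw [hupd k (Finset.mem_range.1 hk)]
    exact norm_sq_le_of_inexact_gradient_step hL hdiff hlip (x k) (v k)
  have hsum := Finset.sum_le_sum hstep
  rw [Finset.sum_add_distrib, ← Finset.mul_sum, ← Finset.mul_sum,
    Finset.sum_range_sub' (fun k => f (x k))] at hsum
  refine hsum.trans ?_
  gcongr
  exact hbdd (x T)
end
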